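/- Let a, b, c, d be real, let n ≥ k ≥ 0 be integers, and let (x,y) be real with x ≠ 1; write u(x,y) = P_{n,k}^{(a,b,c,d)}(x,y) and z = 1−x−y. Then c·u − z·∂u/∂y = (k+c)·P_{n,k}^{(a,b+1,c−1,d)}(x,y), and b·u + y·∂u/∂y = (k+b)·P_{n,k}^{(a,b−1,c+1,d)}(x,y). -/

import Mathlib

noncomputable section

/-- Generalized binomial coefficient `C(α, j) = α(α−1)⋯(α−j+1)/j!`. -/
def genBinom (α : ℝ) (j : ℕ) : ℝ :=
  (∏ i ∈ Finset.range j, (α - i)) / (Nat.factorial j)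

/-- Jacobi polynomial `P_n^{(a,b)}(x)`; zero for negative `n`. -/
def jacobiP (n : ℤ) (a b : ℝ) (x : ℝ) : ℝ :=
  if n < 0 then 0 else
    ∑ m ∈ Finset.range (n.toNat + 1),
      genBinom ((n : ℝ) + a) (n.toNat - m) * genBinom ((n : ℝ) + b) m *
        ((x - 1) / 2) ^ m * ((x + 1) / 2) ^ (n.toNat - m)

/-- Four-parameter Koornwinder polynomial `P_{n,k}^{(a,b,c,d)}(x,y)`;
zero whenever `k < 0`, `n < 0`, or `k > n` (covering the conventions
`k = −1`, `n = −1`, `k = n+1`). -/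
def koornP (n k : ℤ) (a b c d : ℝ) (x y : ℝ) : ℝ :=
  if n < 0 ∨ k < 0 ∨ n < k then 0 else
    jacobiP (n - k) (2 * (k : ℝ) + b + c + d + 1) a (2 * x - 1) *
      (1 - x) ^ k.toNat * jacobiP k c b (-1 + 2 * y / (1 - x))

lemma genBinom_zero (α : ℝ) : genBinom α 0 = 1 := by simp [genBinom]

lemma succ_mul_genBinom_succ (α : ℝ) (j : ℕ) :
    ((j : ℝ) + 1) * genBinom α (j + 1) = (α - j) * genBinom α j := by
  have h : (Nat.factorial j : ℝ) ≠ 0 := by positivity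
  simp only [genBinom, Finset.prod_range_succ, Nat.factorial_succ]
  push_cast
  field_simp

lemma sub_mul_genBinom (α : ℝ) (j : ℕ) :
    (α - j) * genBinom α j = α * genBinom (α - 1) j := by
  have h := (Finset.prod_range_succ (fun i : ℕ => α - (i : ℝ)) j).symm.trans
    (Finset.prod_range_succ' (fun i : ℕ => α - (i : ℝ)) j)
  have e : ∀ i : ℕ, α - ((i + 1 : ℕ) : ℝ) = α - 1 - i := fun i => by push_cast; ring
  simp only [e, Nat.cast_zero, sub_zero] at h
  simp only [genBinom, ← mul_div_assoc]
  rw [mul_comm (α - j), h, mul_comm α]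

/-- Pascal's rule for generalized binomial coefficients. -/
lemma genBinom_add_one_succ (α : ℝ) (j : ℕ) :
    genBinom (α + 1) (j + 1) = genBinom α (j + 1) + genBinom α j := by
  have hj : (j : ℝ) + 1 ≠ 0 := by positivity
  have h₁ := succ_mul_genBinom_succ (α + 1) j
  have h₂ := succ_mul_genBinom_succ α j
  have h₃ := sub_mul_genBinom (α + 1) j
  rw [add_sub_cancel_right] at h₃
  apply mul_left_cancel₀ hj
  linear_combination h₁ - h₂ + h₃

/-- The homogeneous form of the Jacobi polynomial, in `u = (x - 1) / 2` and `v = (x + 1) / 2`. -/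
def jacobiForm (k : ℕ) (a b u v : ℝ) : ℝ :=
  ∑ p ∈ Finset.HasAntidiagonal.antidiagonal k,
    genBinom (k + a) p.2 * genBinom (k + b) p.1 * u ^ p.1 * v ^ p.2

/-- The derivative of `jacobiForm` in the direction `(1, 1)`. -/
def jacobiFormDeriv (k : ℕ) (a b u v : ℝ) : ℝ :=
  ∑ p ∈ Finset.HasAntidiagonal.antidiagonal k,
    genBinom (k + a) p.2 * genBinom (k + b) p.1 *
      (p.1 * u ^ (p.1 - 1) * v ^ p.2 + u ^ p.1 * (p.2 * v ^ (p.2 - 1)))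

lemma jacobiForm_swap (k : ℕ) (a b u v : ℝ) :
    jacobiForm k a b u v = jacobiForm k b a v u := by
  rw [jacobiForm, jacobiForm, ← Finset.Nat.sum_antidiagonal_swap]
  refine Finset.sum_congr rfl fun p _ => ?_
  simp only [Prod.fst_swap, Prod.snd_swap]
  ring

lemma jacobiFormDeriv_swap (k : ℕ) (a b u v : ℝ) :
    jacobiFormDeriv k a b u v = jacobiFormDeriv k b a v u := by
  rw [jacobiFormDeriv, jacobiFormDeriv, ← Finset.Nat.sum_antidiagonal_swap]
  refine Finset.sum_congr rfl fun p _ => ?_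
  simp only [Prod.fst_swap, Prod.snd_swap]
  ring

lemma jacobiForm_ladder (k : ℕ) (a b u v : ℝ) :
    a * jacobiForm k a b u v + u * jacobiFormDeriv k a b u v =
      (k + a) * jacobiForm k (a - 1) (b + 1) u v := by
  have hsplit : a * jacobiForm k a b u v + u * jacobiFormDeriv k a b u v =
      ∑ p ∈ Finset.HasAntidiagonal.antidiagonal k,
        (a + p.1) * genBinom (k + a) p.2 * genBinom (k + b) p.1 * u ^ p.1 * v ^ p.2 +
      ∑ p ∈ Finset.HasAntidiagonal.antidiagonal k,
        p.2 * genBinom (k + a) p.2 * genBinom (k + b) p.1 * u ^ (p.1 + 1) * v ^ (p.2 - 1) := by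
    rw [jacobiForm, jacobiFormDeriv, Finset.mul_sum, Finset.mul_sum, ← Finset.sum_add_distrib,
      ← Finset.sum_add_distrib]
    refine Finset.sum_congr rfl fun p _ => ?_
    rcases p with ⟨_ | i, j⟩
    · simp; ring
    · simp only [Nat.add_sub_cancel]; ring
  have hfst : ∀ p ∈ Finset.HasAntidiagonal.antidiagonal k,
      (a + p.1) * genBinom (k + a) p.2 * genBinom (k + b) p.1 * u ^ p.1 * v ^ p.2 =
        (k + a) * genBinom (k + a - 1) p.2 * genBinom (k + b) p.1 * u ^ p.1 * v ^ p.2 := by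
    intro p hp
    have hk : (k : ℝ) = p.1 + p.2 := by exact_mod_cast (Finset.HasAntidiagonal.mem_antidiagonal.mp hp).symm
    rw [← sub_mul_genBinom]
    congr 4
    rw [hk]; ring
  rw [hsplit, Finset.sum_congr rfl hfst, jacobiForm]
  cases k with
  | zero => simp [genBinom_zero]
  | succ n =>
    rw [Finset.Nat.sum_antidiagonal_succ, Finset.Nat.sum_antidiagonal_succ',
      Finset.Nat.sum_antidiagonal_succ, mul_add, Finset.mul_sum]
    simp only [Nat.cast_zero, zero_mul, zero_add, genBinom_zero, Nat.add_sub_cancel]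
    rw [add_assoc, ← Finset.sum_add_distrib]
    congr 1
    · ring_nf
    · refine Finset.sum_congr rfl fun p _ => ?_
      have h := (succ_mul_genBinom_succ ((n + 1 : ℕ) + a) p.2).trans
        (sub_mul_genBinom ((n + 1 : ℕ) + a) p.2)
      rw [← add_assoc _ b 1, genBinom_add_one_succ, ← add_sub_assoc]
      push_cast at h ⊢
      linear_combination genBinom (n + 1 + b) p.1 * u ^ (p.1 + 1) * v ^ p.2 * h

lemma jacobiP_natCast (k : ℕ) (a b x : ℝ) :
    jacobiP k a b x = jacobiForm k a b ((x - 1) / 2) ((x + 1) / 2) := by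
  rw [jacobiP, if_neg (by omega), jacobiForm, Finset.Nat.sum_antidiagonal_eq_sum_range_succ_mk]
  simp

lemma hasDerivAt_jacobiForm (k : ℕ) (a b s : ℝ) :
    HasDerivAt (fun t => jacobiForm k a b (t - 1) t) (jacobiFormDeriv k a b (s - 1) s) s := by
  unfold jacobiForm jacobiFormDeriv
  refine HasDerivAt.fun_sum fun p _ => ?_
  have h := ((((hasDerivAt_id' s).sub_const 1).fun_pow p.1).fun_mul
    ((hasDerivAt_id' s).fun_pow p.2)).const_mul (genBinom (k + a) p.2 * genBinom (k + b) p.1)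
  simpa only [← mul_assoc, mul_one] using h

lemma koornP_eq_jacobiForm (a b c d : ℝ) (n : ℤ) (k : ℕ) (hnk : (k : ℤ) ≤ n) (x y : ℝ) :
    koornP n k a b c d x y =
      jacobiP (n - k) (2 * (k : ℝ) + b + c + d + 1) a (2 * x - 1) * (1 - x) ^ k *
        jacobiForm k c b (y / (1 - x) - 1) (y / (1 - x)) := by
  rw [koornP, if_neg (by omega), jacobiP_natCast]
  congr 2
  · ring
  · ring

lemma hasDerivAt_koornP (a b c d : ℝ) (n : ℤ) (k : ℕ) (hnk : (k : ℤ) ≤ n) (x y : ℝ) :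
    HasDerivAt (koornP n k a b c d x)
      (jacobiP (n - k) (2 * (k : ℝ) + b + c + d + 1) a (2 * x - 1) * (1 - x) ^ k *
        (jacobiFormDeriv k c b (y / (1 - x) - 1) (y / (1 - x)) * (1 / (1 - x)))) y := by
  rw [funext (koornP_eq_jacobiForm a b c d n k hnk x)]
  exact ((hasDerivAt_jacobiForm k c b (y / (1 - x))).comp y
    ((hasDerivAt_id y).div_const (1 - x))).const_mul _

theorem koorn_ladder_M06 (a b c d : ℝ) (n k : ℤ) (hk : 0 ≤ k) (hnk : k ≤ n)
    (x y : ℝ) (hx : x ≠ 1) :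
    c * koornP n k a b c d x y - (1 - x - y) * deriv (koornP n k a b c d x) y
      = ((k : ℝ) + c) * koornP n k a (b + 1) (c - 1) d x y ∧
    b * koornP n k a b c d x y + y * deriv (koornP n k a b c d x) y
      = ((k : ℝ) + b) * koornP n k a (b - 1) (c + 1) d x y := by
  lift k to ℕ using hk
  have hx' : 1 - x ≠ 0 := sub_ne_zero.mpr hx.symm
  rw [(hasDerivAt_koornP a b c d n k hnk x y).deriv]
  simp only [koornP_eq_jacobiForm _ _ _ _ n k hnk, Int.cast_natCast]
  rw [show 2 * (k : ℝ) + (b + 1) + (c - 1) + d + 1 = 2 * k + b + c + d + 1 by ring,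
    show 2 * (k : ℝ) + (b - 1) + (c + 1) + d + 1 = 2 * k + b + c + d + 1 by ring]
  obtain ⟨s, rfl⟩ : ∃ s, y = s * (1 - x) := ⟨y / (1 - x), (div_mul_cancel₀ y hx').symm⟩
  rw [mul_div_cancel_right₀ s hx']
  have hinv : (1 - x) * (1 / (1 - x)) = 1 := mul_one_div_cancel hx'
  set D := jacobiFormDeriv k c b (s - 1) s with hD
  set Q := jacobiP (n - k) (2 * (k : ℝ) + b + c + d + 1) a (2 * x - 1) * (1 - x) ^ k
  have h₁ := jacobiForm_ladder k c b (s - 1) s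
  have h₂ := jacobiForm_ladder k b c s (s - 1)
  rw [jacobiForm_swap k b c, jacobiFormDeriv_swap k b c, jacobiForm_swap k (b - 1) (c + 1), ← hD] at h₂
  rw [← hD] at h₁
  constructor
  · linear_combination Q * h₁ - Q * D * (1 - s) * hinv
  · linear_combination Q * h₂ + Q * D * s * hinv
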